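/- arXiv:2304.09666 — 6 statements merged into one kernel-verified Lean document; each statement's English description precedes it below -/
import Mathlib

section
/- Let G=(V,E) be a finite simple graph, let 𝒞 be a set of colors, and for each vertex v let L_v ⊆ 𝒞 be a finite color list and d_v : 𝒞 → ℕ a defect function. If for every vertex v we have ∑_{x∈L_v}(d_v(x)+1) > deg_G(v), then there exists a coloring φ : V → 𝒞 with φ(v) ∈ L_v for every v such that every vertex v has at most d_v(φ(v)) neighbors u with φ(u) = φ(v). -/
/-- A double sum of a symmetric function vanishing on the diagonal, with the terms involving a
fixed index split off. -/
theorem sum_sum_eq_two_mul_add_of_symm {V : Type*} [Fintype V] [DecidableEq V] (a : V → V → ℤ)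
    (hsymm : ∀ u w, a u w = a w u) (hdiag : ∀ u, a u u = 0) (v : V) :
    ∑ u, ∑ w, a u w = 2 * ∑ w, a v w +
      ∑ u ∈ Finset.univ.erase v, ∑ w ∈ Finset.univ.erase v, a u w := by
  have hrow : ∀ u, ∑ w, a u w = a u v + ∑ w ∈ Finset.univ.erase v, a u w := fun u =>
    (Finset.add_sum_erase _ _ (Finset.mem_univ v)).symm
  rw [← Finset.add_sum_erase _ _ (Finset.mem_univ v), two_mul, add_assoc]
  congr 1
  rw [Finset.sum_congr rfl fun u _ => hrow u, Finset.sum_add_distrib, hrow v, hdiag, zero_add,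
    Finset.sum_congr rfl fun w _ => hsymm v w]

/-- If the list of `v` has total weight exceeding the degree of `v`, then some color of the list
appears on few enough neighbors of `v`. -/
theorem exists_mem_card_filter_neighborFinset_le {V C : Type*} [Fintype V] [DecidableEq C]
    (G : SimpleGraph V) [DecidableRel G.Adj] (φ : V → C) (v : V) (s : Finset C) (d : C → ℕ)
    (h : G.degree v < ∑ x ∈ s, (d x + 1)) :
    ∃ x ∈ s, ((G.neighborFinset v).filter (fun u => φ u = x)).card ≤ d x := by
  by_contra! hlt
  refine h.not_ge ((Finset.sum_le_sum fun x hx => Nat.succ_le_of_lt (hlt x hx)).trans ?_)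
  rw [← G.card_neighborFinset_eq_degree, Finset.sum_card_fiberwise_eq_card_filter]
  exact Finset.card_filter_le _ _

/-- The number of ordered adjacent pairs of equal color minus twice the total allowed defect. -/
def defectPotential {V C : Type*} [Fintype V] [DecidableEq C]
    (G : SimpleGraph V) [DecidableRel G.Adj] (d : V → C → ℕ) (φ : V → C) : ℤ :=
  ∑ u, ∑ w, (if G.Adj u w ∧ φ u = φ w then 1 else 0) - 2 * ∑ u, (d u (φ u) : ℤ)

/-- The effect on `defectPotential` of recoloring one vertex. -/
theorem defectPotential_update_sub {V C : Type*} [Fintype V] [DecidableEq V] [DecidableEq C]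
    (G : SimpleGraph V) [DecidableRel G.Adj] (d : V → C → ℕ) (φ : V → C) (v : V) (x : C) :
    defectPotential G d (Function.update φ v x) - defectPotential G d φ =
      2 * ((((G.neighborFinset v).filter (fun u => φ u = x)).card - d v x : ℤ) -
        (((G.neighborFinset v).filter (fun u => φ u = φ v)).card - d v (φ v))) := by
  have hsplit : ∀ ψ : V → C, (∀ u, u ≠ v → ψ u = φ u) → defectPotential G d ψ =
      2 * (((G.neighborFinset v).filter (fun u => φ u = ψ v)).card - d v (ψ v) : ℤ) +
      (∑ u ∈ Finset.univ.erase v, ∑ w ∈ Finset.univ.erase v,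
        (if G.Adj u w ∧ φ u = φ w then 1 else 0) -
        2 * ∑ u ∈ Finset.univ.erase v, (d u (φ u) : ℤ)) := by
    intro ψ hψ
    have hrest : ∑ u ∈ Finset.univ.erase v, ∑ w ∈ Finset.univ.erase v,
        (if G.Adj u w ∧ ψ u = ψ w then (1 : ℤ) else 0) =
        ∑ u ∈ Finset.univ.erase v, ∑ w ∈ Finset.univ.erase v,
        (if G.Adj u w ∧ φ u = φ w then (1 : ℤ) else 0) :=
      Finset.sum_congr rfl fun u hu => Finset.sum_congr rfl fun w hw => by
        rw [hψ u (Finset.ne_of_mem_erase hu), hψ w (Finset.ne_of_mem_erase hw)]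
    have hdefect : ∑ u ∈ Finset.univ.erase v, (d u (ψ u) : ℤ) =
        ∑ u ∈ Finset.univ.erase v, (d u (φ u) : ℤ) :=
      Finset.sum_congr rfl fun u hu => by rw [hψ u (Finset.ne_of_mem_erase hu)]
    have hrow : ∑ w, (if G.Adj v w ∧ ψ v = ψ w then (1 : ℤ) else 0) =
        ((G.neighborFinset v).filter (fun u => φ u = ψ v)).card := by
      rw [Finset.sum_boole]
      congr 2
      ext w
      simp only [Finset.mem_filter, Finset.mem_univ, true_and, SimpleGraph.mem_neighborFinset]
      refine and_congr_right fun hw => ?_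
      rw [hψ w hw.ne', eq_comm]
    rw [defectPotential, sum_sum_eq_two_mul_add_of_symm _ (fun u w => by
      simp only [G.adj_comm u w, eq_comm (a := ψ u)]) (fun u => by simp) v,
      hrow, ← Finset.add_sum_erase _ _ (Finset.mem_univ v), hrest, hdefect]
    ring
  rw [hsplit φ fun _ _ => rfl,
    hsplit (Function.update φ v x) fun u hu => Function.update_of_ne hu _ _,
    Function.update_self]
  ring

/-- **List defective coloring existence** (Lemma: if for every vertex `v` we have
`∑_{x ∈ L v} (d v x + 1) > deg_G(v)`, then a list defective coloring exists). -/
theorem list_defective_coloring_exists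
    {V C : Type*} [Fintype V] [DecidableEq V] [DecidableEq C]
    (G : SimpleGraph V) [DecidableRel G.Adj]
    (L : V → Finset C) (d : V → C → ℕ)
    (h : ∀ v : V, G.degree v < ∑ x ∈ L v, (d v x + 1)) :
    ∃ φ : V → C, (∀ v : V, φ v ∈ L v) ∧
      ∀ v : V, ((G.neighborFinset v).filter (fun u => φ u = φ v)).card ≤ d v (φ v) := by
  have hne : ∀ v, (L v).Nonempty := fun v =>
    Finset.nonempty_of_sum_ne_zero (Nat.ne_zero_of_lt (h v))
  obtain ⟨φ, hφ, hmin⟩ := Finset.exists_min_image (Fintype.piFinset L) (defectPotential G d)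
    (Fintype.piFinset_nonempty.2 hne)
  rw [Fintype.mem_piFinset] at hφ
  refine ⟨φ, hφ, fun v => ?_⟩
  obtain ⟨x, hx, hcard⟩ := exists_mem_card_filter_neighborFinset_le G φ v (L v) (d v) (h v)
  have hle := hmin (Function.update φ v x) <| Fintype.mem_piFinset.2 fun u => by
    obtain rfl | hu := eq_or_ne u v
    · simpa using hx
    · simpa [hu] using hφ u
  have hsub := defectPotential_update_sub G d φ v x
  omega
end

section
/- Let G=(V,E) be a finite simple graph, let 𝒞 be a set of colors, and for each vertex v let L_v ⊆ 𝒞 be a finite color list and d_v : 𝒞 → ℕ a defect function. If for every vertex v we have ∑_{x∈L_v}(2·d_v(x)+1) > deg_G(v), then there exists a coloring φ : V → 𝒞 with φ(v) ∈ L_v for every v, together with an orientation of the edges of G (an assignment of a direction to every edge), such that every vertex v has at most d_v(φ(v)) out-neighbors u with φ(u) = φ(v). -/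
/-- A graph whose degrees satisfy `deg v ≤ 2 * d v` has an orientation, defined on all pairs of
distinct vertices, in which every vertex `v` has at most `d v` out-neighbors in the graph. -/
theorem SimpleGraph.exists_orientation_card_le {V : Type*} [Fintype V] [DecidableEq V]
    (H : SimpleGraph V) [DecidableRel H.Adj] (d : V → ℕ) (hd : ∀ v, H.degree v ≤ 2 * d v) :
    ∃ o : V → V → Bool, (∀ u v, u ≠ v → o u v ≠ o v u) ∧
      ∀ v, ((H.neighborFinset v).filter (fun u => o v u = true)).card ≤ d v := by
  classical
  let t : H.edgeSet → Finset (Σ _ : V, ℕ) :=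
    fun e => e.1.toFinset.sigma (fun v => Finset.range (d v))
  have hall : ∀ A : Finset H.edgeSet, A.card ≤ (A.biUnion t).card := by
    intro A
    have hW : A.biUnion t =
        (A.biUnion fun e => e.1.toFinset).sigma (fun v => Finset.range (d v)) := by
      ext ⟨v, i⟩
      simp only [t, Finset.mem_biUnion, Finset.mem_sigma]
      tauto
    set W := A.biUnion fun e => e.1.toFinset with hWdef
    have hcount : ∑ e ∈ A, (W.filter fun v => v ∈ e.1).card =
        ∑ v ∈ W, (A.filter fun e => v ∈ e.1).card :=
      Finset.sum_card_bipartiteAbove_eq_sum_card_bipartiteBelow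
        (fun (e : H.edgeSet) (v : V) => v ∈ e.1)
    have hleft : ∀ e ∈ A, (W.filter fun v => v ∈ e.1).card = 2 := by
      intro e he
      rw [← Sym2.card_toFinset_of_not_isDiag e.1 (H.not_isDiag_of_mem_edgeSet e.2)]
      congr 1
      ext v
      simp only [Finset.mem_filter, Sym2.mem_toFinset, and_iff_right_iff_imp, hWdef,
        Finset.mem_biUnion]
      exact fun hv => ⟨e, he, hv⟩
    have hright : ∀ v ∈ W, (A.filter fun e => v ∈ e.1).card ≤ 2 * d v := by
      intro v _
      refine le_trans ?_ (hd v)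
      rw [← H.card_incidenceFinset_eq_degree v]
      refine Finset.card_le_card_of_injOn Subtype.val ?_ Subtype.val_injective.injOn
      intro e he
      have he' := (Finset.mem_filter.1 he).2
      simpa [SimpleGraph.mem_incidenceFinset, SimpleGraph.incidenceSet] using he'
    have h2 := Finset.sum_le_sum hright
    rw [← hcount, Finset.sum_congr rfl hleft, Finset.sum_const, ← Finset.mul_sum] at h2
    rw [hW, Finset.card_sigma]
    simp only [Finset.card_range, smul_eq_mul] at h2 ⊢
    omega
  obtain ⟨f, hf, hft⟩ := (Finset.all_card_le_biUnion_card_iff_exists_injective t).1 hall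
  have hmem : ∀ e, (f e).1 ∈ e.1 ∧ (f e).2 < d (f e).1 := by
    intro e
    simpa [t, Finset.mem_sigma] using hft e
  let tail : Sym2 V → V := fun e => if h : e ∈ H.edgeSet then (f ⟨e, h⟩).1 else e.out.1
  have htail : ∀ e, tail e ∈ e := by
    intro e
    by_cases h : e ∈ H.edgeSet
    · simpa only [tail, h, dite_true] using (hmem ⟨e, h⟩).1
    · simpa only [tail, h, dite_false] using Sym2.out_fst_mem e
  refine ⟨fun u v => decide (tail s(u, v) = u), ?_, ?_⟩
  · intro u v huv
    have h := Sym2.mem_iff.1 (htail s(u, v))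
    change decide (tail s(u, v) = u) ≠ decide (tail s(v, u) = v)
    rw [Sym2.eq_swap (a := v)]
    rcases h with h | h <;> simp [h, huv, huv.symm]
  · intro v
    rw [← Finset.card_range (d v)]
    let g : V → ℕ := fun u => if h : s(v, u) ∈ H.edgeSet then (f ⟨s(v, u), h⟩).2 else 0
    have key : ∀ u ∈ (H.neighborFinset v).filter (fun u => decide (tail s(v, u) = v) = true),
        ∃ h : s(v, u) ∈ H.edgeSet, f ⟨s(v, u), h⟩ = ⟨v, g u⟩ := by
      intro u hu
      rw [Finset.mem_filter, SimpleGraph.mem_neighborFinset, decide_eq_true_eq] at hu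
      have h : s(v, u) ∈ H.edgeSet := hu.1
      refine ⟨h, ?_⟩
      have h1 := hu.2
      simp only [tail, h, dite_true] at h1
      simp only [g, h, dite_true]
      exact Sigma.ext h1 HEq.rfl
    refine Finset.card_le_card_of_injOn g ?_ ?_
    · intro u hu
      obtain ⟨h, he⟩ := key u hu
      have := (hmem ⟨s(v, u), h⟩).2
      rw [he] at this
      simpa using this
    · intro u hu w hw huw
      obtain ⟨h, he⟩ := key u hu
      obtain ⟨h', he'⟩ := key w hw
      have := hf (he.trans ((congrArg _ huw).trans he'.symm))
      exact Sym2.congr_right.1 (congrArg Subtype.val this)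

/-- Isolating the contribution of one index in a double sum of a symmetric function that vanishes
at that diagonal entry. -/
theorem Finset.sum_sum_symm_erase {V R : Type*} [Fintype V] [DecidableEq V] [CommRing R]
    (a : V → V → R) (hsymm : ∀ u w, a u w = a w u) (v : V) (hv : a v v = 0) :
    ∑ u, ∑ w, a u w =
      ∑ u ∈ univ.erase v, ∑ w ∈ univ.erase v, a u w + 2 * ∑ w, a v w := by
  have h1 : ∀ u, ∑ w, a u w = a u v + ∑ w ∈ univ.erase v, a u w :=
    fun u => (add_sum_erase _ _ (mem_univ v)).symm
  have h2 : ∑ u, ∑ w, a u w = ∑ w, a v w + ∑ u ∈ univ.erase v, ∑ w, a u w :=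
    (add_sum_erase _ _ (mem_univ v)).symm
  have h3 : ∑ u ∈ univ.erase v, a u v = ∑ w, a v w := by
    rw [h1 v, hv, zero_add]
    exact sum_congr rfl fun u _ => hsymm u v
  rw [h2, sum_congr rfl fun u _ => h1 u, sum_add_distrib, h3]
  ring

/-- If `∑ x ∈ L v, w v x` exceeds the degree of `v` for every vertex `v`, then there is a list
coloring in which every `v` has fewer than `w v (φ v)` neighbors of its own color. -/
theorem SimpleGraph.exists_list_defective_coloring {V C : Type*} [Fintype V] [DecidableEq V]
    [DecidableEq C] (G : SimpleGraph V) [DecidableRel G.Adj] (L : V → Finset C) (w : V → C → ℕ)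
    (h : ∀ v, G.degree v < ∑ x ∈ L v, w v x) :
    ∃ φ : V → C, (∀ v, φ v ∈ L v) ∧
      ∀ v, ((G.neighborFinset v).filter (fun u => φ u = φ v)).card < w v (φ v) := by
  have hne : (Fintype.piFinset L).Nonempty := by
    rw [Fintype.piFinset_nonempty]
    intro v
    by_contra hv
    have := h v
    simp [Finset.not_nonempty_iff_eq_empty.1 hv] at this
  let a : (V → C) → V → V → ℤ := fun φ u v => if G.Adj u v ∧ φ v = φ u then 1 else 0
  let P : (V → C) → ℤ := fun φ => ∑ u, ∑ v, a φ u v - 2 * ∑ v, (w v (φ v) : ℤ)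
  obtain ⟨φ, hφ, hmin⟩ := Finset.exists_min_image _ P hne
  rw [Fintype.mem_piFinset] at hφ
  refine ⟨φ, hφ, fun v => ?_⟩
  by_contra! hv
  obtain ⟨x, hx, hlt⟩ : ∃ x ∈ L v,
      ((G.neighborFinset v).filter (fun u => φ u = x)).card < w v x := by
    by_contra! hge
    have h1 := Finset.sum_le_sum hge
    have h2 : ∑ x ∈ L v, ((G.neighborFinset v).filter (fun u => φ u = x)).card ≤ G.degree v := by
      rw [← G.card_neighborFinset_eq_degree, Finset.sum_card_fiberwise_eq_card_filter]
      exact Finset.card_filter_le _ _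
    exact absurd (h v) (by omega)
  set ψ := Function.update φ v x with hψ
  have hψv : ψ v = x := Function.update_self ..
  have hψu : ∀ u, u ≠ v → ψ u = φ u := fun u hu => Function.update_of_ne hu ..
  have hψL : ψ ∈ Fintype.piFinset L := by
    rw [Fintype.mem_piFinset]
    intro u
    by_cases hu : u = v
    · rw [hu, hψv]; exact hx
    · rw [hψu u hu]; exact hφ u
  have hsum : ∀ χ : V → C, ∑ u, ∑ u', a χ u u' =
      ∑ u ∈ Finset.univ.erase v, ∑ u' ∈ Finset.univ.erase v, a χ u u' +
        2 * ((G.neighborFinset v).filter (fun u => χ u = χ v)).card := by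
    intro χ
    rw [Finset.sum_sum_symm_erase (a χ) (fun u u' => by simp [a, G.adj_comm, eq_comm]) v
      (by simp [a])]
    simp only [a, Finset.sum_boole]
    congr 4
    ext u
    simp
  have hrest : ∑ u ∈ Finset.univ.erase v, ∑ u' ∈ Finset.univ.erase v, a ψ u u' =
      ∑ u ∈ Finset.univ.erase v, ∑ u' ∈ Finset.univ.erase v, a φ u u' := by
    refine Finset.sum_congr rfl fun u hu => Finset.sum_congr rfl fun u' hu' => ?_
    simp only [a, hψu u (Finset.ne_of_mem_erase hu), hψu u' (Finset.ne_of_mem_erase hu')]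
  have hdeg : ((G.neighborFinset v).filter (fun u => ψ u = ψ v)) =
      (G.neighborFinset v).filter (fun u => φ u = x) := by
    refine Finset.filter_congr fun u hu => ?_
    rw [hψv, hψu u ((G.mem_neighborFinset v u).1 hu).ne']
  have hw : ∑ u, (w u (ψ u) : ℤ) = w v x + ∑ u ∈ Finset.univ.erase v, (w u (φ u) : ℤ) := by
    rw [← Finset.add_sum_erase _ _ (Finset.mem_univ v), hψv]
    congr 1
    exact Finset.sum_congr rfl fun u hu => by rw [hψu u (Finset.ne_of_mem_erase hu)]
  have hw' := Finset.add_sum_erase Finset.univ (fun u => (w u (φ u) : ℤ)) (Finset.mem_univ v)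
  have hle := hmin ψ hψL
  simp only [P, hsum, hrest, hdeg, hw, ← hw'] at hle
  omega

/-- **List arbdefective coloring existence**: if for every vertex `v` we have
`∑_{x ∈ L v} (2 * d v x + 1) > deg_G(v)`, then there is a coloring `φ` with `φ v ∈ L v`
together with an orientation `o` of the edges of `G` such that every vertex `v` has at
most `d v (φ v)` out-neighbors of color `φ v`. -/
theorem list_arbdefective_coloring_exists
    {V C : Type*} [Fintype V] [DecidableEq V] [DecidableEq C]
    (G : SimpleGraph V) [DecidableRel G.Adj]
    (L : V → Finset C) (d : V → C → ℕ)
    (h : ∀ v : V, G.degree v < ∑ x ∈ L v, (2 * d v x + 1)) :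
    ∃ (φ : V → C) (o : V → V → Bool),
      (∀ v : V, φ v ∈ L v) ∧
      (∀ u v : V, G.Adj u v → o u v ≠ o v u) ∧
      ∀ v : V,
        ((G.neighborFinset v).filter (fun u => o v u = true ∧ φ u = φ v)).card
          ≤ d v (φ v) := by
  obtain ⟨φ, hφ, hdef⟩ := G.exists_list_defective_coloring L (fun v x => 2 * d v x + 1) h
  let H : SimpleGraph V :=
    { Adj := fun u v => G.Adj u v ∧ φ v = φ u
      symm := ⟨fun _ _ h => ⟨h.1.symm, h.2.symm⟩⟩
      loopless := ⟨fun v h => G.loopless.irrefl v h.1⟩ }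
  have : DecidableRel H.Adj := fun u v => inferInstanceAs (Decidable (G.Adj u v ∧ φ v = φ u))
  have hH : ∀ v, H.neighborFinset v = (G.neighborFinset v).filter (fun u => φ u = φ v) := by
    intro v
    ext u
    simp [H]
  obtain ⟨o, ho, hout⟩ := H.exists_orientation_card_le (fun v => d v (φ v)) fun v => by
    rw [← H.card_neighborFinset_eq_degree, hH]
    exact Nat.lt_succ_iff.1 (hdef v)
  refine ⟨φ, o, hφ, fun u v huv => ho u v huv.ne, fun v => ?_⟩
  convert hout v using 2
  rw [hH, Finset.filter_filter]
  exact Finset.filter_congr fun u _ => and_comm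
end

section
/- Let Δ ≥ 1 and let G be the complete graph on Δ+1 vertices. Let L ⊆ 𝒞 be a finite color list and d : 𝒞 → ℕ a defect function, the same for all vertices, such that ∑_{x∈L}(2·d(x)+1) = Δ. Then for every coloring φ assigning each vertex a color from L and every orientation of the edges of G, there exists a vertex v having strictly more than d(φ(v)) out-neighbors u with φ(u) = φ(v). -/
/-- In a tournament on a finite set `s`, twice the sum of the out-degrees plus the number of
vertices is the square of the number of vertices. -/
theorem two_mul_sum_card_outNeighbors_add_card {V : Type*} [DecidableEq V] (s : Finset V)
    (o : V → V → Bool) (ho : ∀ u v, u ≠ v → o u v ≠ o v u) :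
    2 * ∑ v ∈ s, (s.filter (fun u => u ≠ v ∧ o v u = true)).card + s.card =
      s.card * s.card := by
  have h_swap : ∑ v ∈ s, ∑ u ∈ s, (if u ≠ v ∧ o v u = true then 1 else 0) =
      ∑ v ∈ s, ∑ u ∈ s, (if v ≠ u ∧ o u v = true then 1 else 0) := Finset.sum_comm
  have h_diag : ∑ v ∈ s, ∑ u ∈ s, (if v = u then 1 else 0) = s.card := by
    simp
  have h_total : ∑ v ∈ s, ∑ u ∈ s, ((if u ≠ v ∧ o v u = true then 1 else 0) +
      (if v ≠ u ∧ o u v = true then 1 else 0) + (if v = u then 1 else 0)) =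
      s.card * s.card := by
    have h_one : ∀ v u, (if u ≠ v ∧ o v u = true then 1 else 0) +
        (if v ≠ u ∧ o u v = true then 1 else 0) + (if v = u then 1 else 0) = 1 := by
      intro v u
      by_cases h : v = u
      · simp [h]
      · have h_ne := ho v u h
        have h_symm : ¬u = v := Ne.symm h
        cases h₁ : o v u <;> cases h₂ : o u v <;> simp_all
    simp only [h_one]
    simp
  simp only [Finset.sum_add_distrib] at h_total
  simp only [Finset.card_filter]
  rw [h_diag, ← h_swap] at h_total
  omega

/-- A tournament on at least `2 * k + 2` vertices has a vertex of out-degree more than `k`. -/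
theorem exists_lt_card_outNeighbors {V : Type*} [DecidableEq V] (s : Finset V)
    (o : V → V → Bool) (ho : ∀ u v, u ≠ v → o u v ≠ o v u) (k : ℕ) (hk : 2 * k + 1 < s.card) :
    ∃ v ∈ s, k < (s.filter (fun u => u ≠ v ∧ o v u = true)).card := by
  by_contra! h
  have h_sum := Finset.sum_le_card_nsmul s _ k h
  have h_total := two_mul_sum_card_outNeighbors_add_card s o ho
  rw [smul_eq_mul] at h_sum
  nlinarith

/-- **Tightness of the list arbdefective coloring condition on cliques**: on the
complete graph on `Δ+1` vertices (where adjacency is just inequality) with identical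
list `L` and defect function `d` satisfying `∑_{x ∈ L} (2 * d x + 1) = Δ`, for every
coloring from `L` and every orientation of the edges there is a vertex `v` with
strictly more than `d (φ v)` out-neighbors of color `φ v`. -/
theorem list_arbdefective_coloring_tight_on_clique
    {C : Type*} [DecidableEq C] (Δ : ℕ) (hΔ : 1 ≤ Δ)
    (L : Finset C) (d : C → ℕ) (hsum : ∑ x ∈ L, (2 * d x + 1) = Δ)
    (φ : Fin (Δ + 1) → C) (hφ : ∀ v, φ v ∈ L)
    (o : Fin (Δ + 1) → Fin (Δ + 1) → Bool)
    (ho : ∀ u v : Fin (Δ + 1), u ≠ v → o u v ≠ o v u) :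
    ∃ v : Fin (Δ + 1),
      d (φ v) <
        (Finset.univ.filter (fun u => u ≠ v ∧ o v u = true ∧ φ u = φ v)).card := by
  obtain ⟨x, -, hx⟩ : ∃ x ∈ L, 2 * d x + 1 < (Finset.univ.filter (fun v => φ v = x)).card := by
    apply Finset.exists_lt_of_sum_lt
    rw [hsum, ← Finset.card_eq_sum_card_fiberwise (fun v _ => hφ v), Finset.card_univ,
      Fintype.card_fin]
    exact Nat.lt_succ_self Δ
  obtain ⟨v, hv, h⟩ := exists_lt_card_outNeighbors _ o ho (d x) hx
  obtain rfl : φ v = x := (Finset.mem_filter.mp hv).2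
  refine ⟨v, h.trans_le (Finset.card_le_card fun u hu => ?_)⟩
  simp only [Finset.mem_filter, Finset.mem_univ, true_and] at hu ⊢
  exact ⟨hu.2.1, hu.2.2, hu.1⟩
end

section
/- Let γ ≥ 1, m ≥ 2, N ≥ 2 and τ, τ', ℓ be natural numbers such that τ ≥ 8·log₂ γ + 2·log₂ log₂ N + 2·log₂ log₂ m + 16, τ' = 2^(τ − ⌈log₂(2eγ²)⌉), and ℓ ≤ 2eγ²τ. Then 2^(τ') > 16 · m · N^ℓ. -/
/-- Rounding the exponent up loses less than a factor of two. -/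
theorem two_pow_ceil_logb_lt {C : ℝ} (hC : 1 ≤ C) :
    (2 : ℝ) ^ ⌈Real.logb 2 C⌉₊ < 2 * C := by
  have hC0 : 0 < C := by linarith
  have h := Nat.ceil_lt_add_one (Real.logb_nonneg one_lt_two hC)
  calc (2 : ℝ) ^ ⌈Real.logb 2 C⌉₊ = 2 ^ (⌈Real.logb 2 C⌉₊ : ℝ) := (Real.rpow_natCast _ _).symm
    _ < 2 ^ (Real.logb 2 C + 1) := Real.rpow_lt_rpow_of_exponent_lt one_lt_two h
    _ = 2 * C := by
      rw [Real.rpow_add two_pos, Real.rpow_logb two_pos (by norm_num) hC0, Real.rpow_one, mul_comm]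

theorem one_le_logb_two {a : ℕ} (ha : 2 ≤ a) : 1 ≤ Real.logb 2 (a : ℝ) := by
  rw [Real.le_logb_iff_rpow_le one_lt_two (by positivity), Real.rpow_one]
  exact_mod_cast ha

/-- The exponential growth estimate behind the bound on `τ`. -/
theorem mul_add_le_two_pow {g x y : ℝ} {τ : ℕ} (hg : 1 ≤ g) (hx : 1 ≤ x) (hy : 1 ≤ y)
    (hτ : 8 * Real.logb 2 g + 2 * Real.logb 2 x + 2 * Real.logb 2 y + 16 ≤ (τ : ℝ)) :
    60 * g ^ 4 * (4 + y + τ * x) ≤ 2 ^ τ := by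
  have hτ16 : (16 : ℝ) ≤ τ := by
    have := Real.logb_nonneg one_lt_two hg
    have := Real.logb_nonneg one_lt_two hx
    have := Real.logb_nonneg one_lt_two hy
    linarith
  have hlog : Real.logb 2 (2 ^ 8 * g ^ 4 * x * y) ≤ (τ : ℝ) / 2 := by
    rw [Real.logb_mul (by positivity) (by positivity), Real.logb_mul (by positivity) (by positivity),
      Real.logb_mul (by positivity) (by positivity), Real.logb_pow, Real.logb_pow,
      Real.logb_self_eq_one one_lt_two]
    push_cast
    linarith
  rw [Real.logb_le_iff_le_rpow one_lt_two (by positivity)] at hlog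
  have hbern : 1 + (τ : ℝ) / 2 ≤ 2 ^ ((τ : ℝ) / 2) := by
    have := one_add_mul_self_le_rpow_one_add (s := 1) (by norm_num)
      (show (1 : ℝ) ≤ (τ : ℝ) / 2 by linarith)
    norm_num at this ⊢
    exact this
  have hxy : 4 + y + τ * x ≤ (5 + τ) * (x * y) := by
    have h1 : 1 ≤ x * y := one_le_mul_of_one_le_of_one_le hx hy
    have h2 : y ≤ x * y := le_mul_of_one_le_left (by linarith) hx
    have h3 : (τ : ℝ) * x ≤ τ * (x * y) :=
      mul_le_mul_of_nonneg_left (le_mul_of_one_le_right (by linarith) hy) (by linarith)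
    linarith
  calc 60 * g ^ 4 * (4 + y + τ * x) ≤ 60 * g ^ 4 * ((5 + τ) * (x * y)) := by gcongr
    _ = (2 ^ 8 * g ^ 4 * x * y) * (60 / 256 * (5 + τ)) := by ring
    _ ≤ 2 ^ ((τ : ℝ) / 2) * 2 ^ ((τ : ℝ) / 2) := by
      gcongr
      linarith
    _ = 2 ^ τ := by rw [← Real.rpow_add two_pos, add_halves, Real.rpow_natCast]


/-- **Helper inequality** (Claim: `2^τ' > 16 · m · N^ℓ`): if `γ ≥ 1`, `m ≥ 2`, `N ≥ 2`,
`τ ≥ 8·log₂ γ + 2·log₂ log₂ N + 2·log₂ log₂ m + 16`,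
`τ' = 2^(τ − ⌈log₂(2eγ²)⌉)` and `ℓ ≤ 2eγ²τ`, then `2^τ' > 16 · m · N^ℓ`. -/
theorem two_pow_tau'_gt
    (γ m N τ τ' ℓ : ℕ) (hγ : 1 ≤ γ) (hm : 2 ≤ m) (hN : 2 ≤ N)
    (hτ : 8 * Real.logb 2 (γ : ℝ) + 2 * Real.logb 2 (Real.logb 2 (N : ℝ))
            + 2 * Real.logb 2 (Real.logb 2 (m : ℝ)) + 16 ≤ (τ : ℝ))
    (hτ' : τ' = 2 ^ (τ - ⌈Real.logb 2 (2 * Real.exp 1 * (γ : ℝ) ^ 2)⌉₊))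
    (hℓ : (ℓ : ℝ) ≤ 2 * Real.exp 1 * (γ : ℝ) ^ 2 * (τ : ℝ)) :
    16 * m * N ^ ℓ < 2 ^ τ' := by
  set C : ℝ := 2 * Real.exp 1 * (γ : ℝ) ^ 2 with hCdef
  have hg : (1 : ℝ) ≤ γ := by exact_mod_cast hγ
  have he := Real.exp_one_lt_d9
  have he' := Real.exp_one_gt_d9
  have hC : 1 ≤ C := by
    have h2 : (1 : ℝ) ≤ (γ : ℝ) ^ 2 := one_le_pow₀ hg
    nlinarith
  have hCsq : 2 * C ^ 2 ≤ 60 * (γ : ℝ) ^ 4 := by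
    have h : 8 * Real.exp 1 ^ 2 ≤ 60 := by nlinarith
    calc 2 * C ^ 2 = 8 * Real.exp 1 ^ 2 * (γ : ℝ) ^ 4 := by rw [hCdef]; ring
      _ ≤ _ := by gcongr
  have hx := one_le_logb_two hN
  have hy := one_le_logb_two hm
  have hmain := mul_add_le_two_pow hg hx hy hτ
  set x := Real.logb 2 (N : ℝ)
  set y := Real.logb 2 (m : ℝ)
  set k := ⌈Real.logb 2 C⌉₊
  have hk : (2 : ℝ) ^ k < 2 * C := two_pow_ceil_logb_lt hC
  have hτ'pos : (0 : ℝ) < τ' := by rw [hτ']; positivity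
  have hτ'k : (2 : ℝ) ^ τ ≤ τ' * 2 ^ k := by
    rw [hτ']
    push_cast
    rw [← pow_add]
    exact pow_le_pow_right₀ one_le_two (by omega)
  have hexp : 4 + y + x * ℓ < τ' := by
    have hlt : 2 * C * (4 + y + x * ℓ) < 2 * C * τ' :=
      calc 2 * C * (4 + y + x * ℓ) ≤ 2 * C * (C * (4 + y) + x * (C * τ)) := by
            gcongr
            exact le_mul_of_one_le_left (by linarith) hC
        _ = 2 * C ^ 2 * (4 + y + τ * x) := by ring
        _ ≤ 60 * (γ : ℝ) ^ 4 * (4 + y + τ * x) := by gcongr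
        _ ≤ 2 ^ τ := hmain
        _ ≤ τ' * 2 ^ k := hτ'k
        _ < τ' * (2 * C) := by gcongr
        _ = 2 * C * τ' := mul_comm _ _
    exact lt_of_mul_lt_mul_left hlt (by positivity)
  have hreal : (16 * m * N ^ ℓ : ℝ) < 2 ^ τ' :=
    calc (16 * m * N ^ ℓ : ℝ) = 2 ^ (4 + y + x * ℓ) := by
          rw [Real.rpow_add two_pos, Real.rpow_add two_pos, Real.rpow_mul two_pos.le,
            Real.rpow_logb two_pos (by norm_num) (by positivity),
            Real.rpow_logb two_pos (by norm_num) (by positivity), Real.rpow_natCast]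
          norm_num
      _ < 2 ^ (τ' : ℝ) := Real.rpow_lt_rpow_of_exponent_lt one_lt_two hexp
      _ = 2 ^ τ' := Real.rpow_natCast _ _
  exact_mod_cast hreal
end

section
/- Let α be a type, let t ≥ 1, let A₁, …, A_t be nonempty finite subsets of α, let R : α → α → Prop be a (conflict) relation, and let d₁, …, d_t be natural numbers such that (i) for all i, j ∈ {1,…,t} with i ≠ j and every b ∈ A_j, the number of a ∈ A_i with R(a,b) or R(b,a) is at most d_i, and (ii) for every i, (t−1)·d_i < |A_i|. Then there exists a selection a_1 ∈ A_1, …, a_t ∈ A_t such that for all i ≠ j, neither R(a_i, a_j) nor R(a_j, a_i) holds. -/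
/-- If each `b j`, `j ∈ S`, is related to at most `d` elements of `A` and `#S * d < #A`, then some
element of `A` is related to no `b j`. -/
theorem Finset.exists_mem_forall_not_of_card_mul_lt {α ι : Type*} (A : Finset α) (S : Finset ι)
    (P : α → ι → Prop) (d : ℕ) (hd : ∀ j ∈ S, Set.ncard {x | x ∈ A ∧ P x j} ≤ d)
    (hlt : S.card * d < A.card) : ∃ x ∈ A, ∀ j ∈ S, ¬ P x j := by
  classical
  have hbad : (S.biUnion fun j => A.filter (P · j)).card < A.card := by
    refine (Finset.card_biUnion_le_card_mul _ _ d fun j hj => ?_).trans_lt hlt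
    rw [← Set.ncard_coe_finset, Finset.coe_filter]
    exact hd j hj
  obtain ⟨x, hx, hxn⟩ := Finset.exists_mem_notMem_of_card_lt_card hbad
  refine ⟨x, hx, fun j hj hP => hxn ?_⟩
  exact Finset.mem_biUnion.2 ⟨j, hj, Finset.mem_filter.2 ⟨hx, hP⟩⟩

/-- **Greedy conflict-free selection principle**: given `t ≥ 1` types with nonempty
candidate pools `A i`, a conflict relation `R`, and bounds `d i` such that each fixed
object conflicts (in either direction) with at most `d i` objects of pool `A i`, and
`(t−1)·d i < |A i|` for every `i`, one can pick one object per type so that no two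
picked objects (of distinct types) conflict. -/
theorem greedy_conflict_free_selection
    {α : Type*} (t : ℕ) (ht : 1 ≤ t) (A : Fin t → Finset α)
    (hA : ∀ i, (A i).Nonempty) (R : α → α → Prop) (d : Fin t → ℕ)
    (hconf : ∀ i j : Fin t, i ≠ j → ∀ b ∈ A j,
      Set.ncard {a | a ∈ A i ∧ (R a b ∨ R b a)} ≤ d i)
    (hsize : ∀ i : Fin t, (t - 1) * d i < (A i).card) :
    ∃ a : Fin t → α, (∀ i, a i ∈ A i) ∧
      ∀ i j : Fin t, i ≠ j → ¬ R (a i) (a j) ∧ ¬ R (a j) (a i) := by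
  classical
  suffices h : ∀ S : Finset (Fin t), ∃ a : Fin t → α, (∀ i, a i ∈ A i) ∧
      ∀ i ∈ S, ∀ j ∈ S, i ≠ j → ¬ R (a i) (a j) ∧ ¬ R (a j) (a i) by
    obtain ⟨a, ha, h⟩ := h Finset.univ
    exact ⟨a, ha, fun i j => h i (Finset.mem_univ i) j (Finset.mem_univ j)⟩
  intro S
  induction S using Finset.induction_on with
  | empty =>
    choose a ha using hA
    exact ⟨a, ha, by simp⟩
  | insert k S hk ih =>
    obtain ⟨a, ha, h⟩ := ih
    have hcard : S.card ≤ t - 1 := by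
      have hle := Finset.card_le_univ (insert k S)
      rw [Finset.card_insert_of_notMem hk, Fintype.card_fin] at hle
      omega
    have hne : ∀ j ∈ S, j ≠ k := fun j hj => ne_of_mem_of_not_mem hj hk
    obtain ⟨x, hx, hfree⟩ := Finset.exists_mem_forall_not_of_card_mul_lt (A k) S
      (fun x j => R x (a j) ∨ R (a j) x) (d k)
      (fun j hj => hconf k j (hne j hj).symm (a j) (ha j))
      ((Nat.mul_le_mul_right _ hcard).trans_lt (hsize k))
    refine ⟨Function.update a k x, fun i => ?_, fun i hi j hj hij => ?_⟩
    · obtain rfl | hik := eq_or_ne i k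
      · simpa using hx
      · simpa [hik] using ha i
    · obtain rfl | hiS := Finset.mem_insert.1 hi <;> obtain rfl | hjS := Finset.mem_insert.1 hj
      · exact absurd rfl hij
      · simpa [hne j hjS] using hfree j hjS
      · simpa [hne i hiS, and_comm] using hfree i hiS
      · simpa [hne i hiS, hne j hjS] using h i hiS j hjS hij
end

section
/- Let G=(V,E) be a finite simple graph with color lists L_v ⊆ 𝒞 and defect functions d_v : 𝒞 → ℤ. For a coloring φ : V → 𝒞, let M(φ) denote the number of edges {u,w} ∈ E with φ(u) = φ(w), and define the integer potential Φ(φ) := M(φ) + ∑_{v∈V}(deg_G(v) − d_v(φ(v))). Suppose φ is a coloring, v is a vertex with strictly more than d_v(φ(v)) neighbors u satisfying φ(u) = φ(v), and y ∈ 𝒞 is a color such that v has at most d_v(y) neighbors u with φ(u) = y. Let φ' be the coloring obtained from φ by recoloring v with y. Then Φ(φ') ≤ Φ(φ) − 1. -/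
/-- The number of monochromatic edges of the coloring `φ`. -/
def monoEdges {V C : Type*} [Fintype V] [DecidableEq V] [DecidableEq C]
    (G : SimpleGraph V) [DecidableRel G.Adj] (φ : V → C) : ℕ :=
  (G.edgeFinset.filter (fun e => (Sym2.map φ e).IsDiag)).card

/-- The potential `Φ(φ) = M(φ) + ∑_v (deg_G(v) − d_v(φ(v)))` as an integer. -/
def potential {V C : Type*} [Fintype V] [DecidableEq V] [DecidableEq C]
    (G : SimpleGraph V) [DecidableRel G.Adj] (d : V → C → ℤ) (φ : V → C) : ℤ :=
  (monoEdges G φ : ℤ) + ∑ w : V, ((G.degree w : ℤ) - d w (φ w))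

/-- The monochromatic edges split into those avoiding `v` and those joining `v` to a neighbor
of its own color. -/
theorem monoEdges_eq_add_card_neighborFinset {V C : Type*} [Fintype V] [DecidableEq V]
    [DecidableEq C] (G : SimpleGraph V) [DecidableRel G.Adj] (φ : V → C) (v : V) :
    monoEdges G φ =
      (G.edgeFinset.filter (fun e => (Sym2.map φ e).IsDiag ∧ v ∉ e)).card +
        ((G.neighborFinset v).filter (fun u => φ u = φ v)).card := by
  have himage : G.edgeFinset.filter (fun e => (Sym2.map φ e).IsDiag ∧ v ∈ e) =
      ((G.neighborFinset v).filter (fun u => φ u = φ v)).image (fun u => s(v, u)) := by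
    ext e
    simp only [Finset.mem_filter, Finset.mem_image, SimpleGraph.mem_edgeFinset,
      SimpleGraph.mem_neighborFinset]
    constructor
    · rintro ⟨he, hd, hv⟩
      obtain ⟨u, rfl⟩ := Sym2.mem_iff_exists.mp hv
      exact ⟨u, ⟨he, (Sym2.mk_isDiag_iff.mp hd).symm⟩, rfl⟩
    · rintro ⟨u, ⟨hu, hc⟩, rfl⟩
      exact ⟨hu, Sym2.mk_isDiag_iff.mpr hc.symm, Sym2.mem_mk_left v u⟩
  have hcard : (G.edgeFinset.filter (fun e => (Sym2.map φ e).IsDiag ∧ v ∈ e)).card =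
      ((G.neighborFinset v).filter (fun u => φ u = φ v)).card := by
    rw [himage, Finset.card_image_of_injective]
    exact fun _ _ h => Sym2.congr_right.mp h
  rw [← hcard, monoEdges, add_comm, ← Finset.filter_filter, ← Finset.filter_filter,
    Finset.card_filter_add_card_filter_not]

/-- Recoloring `v` with `y` trades the neighbors of the old color of `v` for those of
color `y`. -/
theorem monoEdges_update_add {V C : Type*} [Fintype V] [DecidableEq V]
    [DecidableEq C] (G : SimpleGraph V) [DecidableRel G.Adj] (φ : V → C) (v : V) (y : C) :
    monoEdges G (Function.update φ v y) +
        ((G.neighborFinset v).filter (fun u => φ u = φ v)).card =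
      monoEdges G φ + ((G.neighborFinset v).filter (fun u => φ u = y)).card := by
  have hedges : G.edgeFinset.filter
        (fun e => (Sym2.map (Function.update φ v y) e).IsDiag ∧ v ∉ e) =
      G.edgeFinset.filter (fun e => (Sym2.map φ e).IsDiag ∧ v ∉ e) := by
    refine Finset.filter_congr fun e _ => and_congr_left fun hv => ?_
    rw [Sym2.map_congr fun x hx =>
      Function.update_of_ne (ne_of_mem_of_not_mem hx hv) y φ]
  have hneighbors : (G.neighborFinset v).filter
        (fun u => Function.update φ v y u = Function.update φ v y v) =
      (G.neighborFinset v).filter (fun u => φ u = y) := by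
    refine Finset.filter_congr fun u hu => ?_
    rw [Function.update_self,
      Function.update_of_ne ((G.mem_neighborFinset v u).mp hu).ne']
  rw [monoEdges_eq_add_card_neighborFinset G _ v,
    monoEdges_eq_add_card_neighborFinset G φ v, hedges, hneighbors]
  omega


/-- **Potential decrease when recoloring an unhappy vertex**: if `v` has strictly more
than `d v (φ v)` neighbors of color `φ v` and at most `d v y` neighbors of color `y`,
then recoloring `v` with `y` decreases the potential `Φ` by at least `1`. -/
theorem potential_decreases
    {V C : Type*} [Fintype V] [DecidableEq V] [DecidableEq C]
    (G : SimpleGraph V) [DecidableRel G.Adj]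
    (d : V → C → ℤ) (φ : V → C) (v : V) (y : C)
    (h1 : d v (φ v)
        < (((G.neighborFinset v).filter (fun u => φ u = φ v)).card : ℤ))
    (h2 : ((((G.neighborFinset v).filter (fun u => φ u = y)).card : ℤ)) ≤ d v y) :
    potential G d (Function.update φ v y) ≤ potential G d φ - 1 := by
  have hmono := monoEdges_update_add G φ v y
  have hsum : ∑ w ∈ Finset.univ.erase v,
        ((G.degree w : ℤ) - d w (Function.update φ v y w)) =
      ∑ w ∈ Finset.univ.erase v, ((G.degree w : ℤ) - d w (φ w)) :=
    Finset.sum_congr rfl fun w hw => by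
      rw [Function.update_of_ne (Finset.ne_of_mem_erase hw)]
  unfold potential
  rw [← Finset.add_sum_erase _ _ (Finset.mem_univ v),
    ← Finset.add_sum_erase _ (fun w => (G.degree w : ℤ) - d w (φ w)) (Finset.mem_univ v),
    hsum, Function.update_self]
  omega
end
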